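/- Let n, k ≥ 3 be integers and let F(n,k) be the (n,k)-firecrackers tree. Then the line graph 𝓛(F(n,k)) is a lower bound block graph and rn(𝓛(F(n,k))) = (n²+1)k/2 + 4n − 6 if n is odd, and rn(𝓛(F(n,k))) = n²k/2 + 4n − 5 if n is even. -/

import Mathlib

open scoped Classical

namespace RadioLabeling

variable {V : Type*} [Fintype V]

/-- The diameter of a graph: maximum distance between two vertices. -/
noncomputable def diam (G : SimpleGraph V) : ℕ :=
  Finset.univ.sup fun p : V × V => G.dist p.1 p.2

/-- A vertex set `S` induces a 2-connected subgraph: the induced subgraph is connected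
and contains no cut-vertex. -/
def TwoConn (G : SimpleGraph V) (S : Set V) : Prop :=
  (G.induce S).Connected ∧ ∀ v ∈ S, (S \ {v} : Set V) = ∅ ∨ (G.induce (S \ {v})).Connected

/-- A block: a maximal 2-connected induced subgraph. -/
def IsBlock (G : SimpleGraph V) (S : Set V) : Prop :=
  TwoConn G S ∧ ∀ T : Set V, S ⊆ T → TwoConn G T → T = S

/-- A block graph: a connected graph each of whose blocks is a clique. -/
def IsBlockGraph (G : SimpleGraph V) : Prop :=
  G.Connected ∧ ∀ S : Set V, IsBlock G S → G.IsClique S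

/-- The weight of `G` at `v`: the sum of distances from `v` to all vertices. -/
noncomputable def wt (G : SimpleGraph V) (v : V) : ℕ := ∑ u : V, G.dist u v

/-- The set of weight centers: vertices minimizing the weight. -/
def weightCenters (G : SimpleGraph V) : Set V := {v | ∀ u : V, wt G v ≤ wt G u}

/-- `nCloser G v u` = number of vertices strictly closer to `v` than to `u`. -/
noncomputable def nCloser (G : SimpleGraph V) (v u : V) : ℕ :=
  (Finset.univ.filter fun z => G.dist v z < G.dist u z).card

/-- A central vertex: either the unique weight center, or (when there are at least two
weight centers) a vertex of the central block, i.e. of a block containing all weight centers. -/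
def IsCentral (G : SimpleGraph V) (w : V) : Prop :=
  weightCenters G = {w} ∨
    (2 ≤ (weightCenters G).ncard ∧
      ∃ S : Set V, IsBlock G S ∧ weightCenters G ⊆ S ∧ w ∈ S)

/-- The level of a vertex: its distance to a nearest central vertex. -/
noncomputable def level (G : SimpleGraph V) (v : V) : ℕ :=
  sInf {n | ∃ w, IsCentral G w ∧ G.dist v w = n}

/-- The total level of `G`. -/
noncomputable def totalLevel (G : SimpleGraph V) : ℕ := ∑ v : V, level G v

/-- `eps G = 1` if `G` has a unique weight center, `0` otherwise. -/
noncomputable def eps (G : SimpleGraph V) : ℕ :=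
  if (weightCenters G).ncard = 1 then 1 else 0

/-- A radio labeling: `|f u - f v| ≥ diam G + 1 - dist u v` for all distinct `u`, `v`. -/
def IsRadioLabeling (G : SimpleGraph V) (f : V → ℕ) : Prop :=
  ∀ u v : V, u ≠ v → diam G + 1 ≤ G.dist u v + max (f u - f v) (f v - f u)

/-- The span of a labeling: the maximum difference of two labels. -/
noncomputable def span (f : V → ℕ) : ℕ :=
  Finset.univ.sup fun p : V × V => f p.1 - f p.2

/-- The radio number: minimum span of a radio labeling. -/
noncomputable def rn (G : SimpleGraph V) : ℕ :=
  sInf {s | ∃ f : V → ℕ, IsRadioLabeling G f ∧ span f = s}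

/-- `G` achieves the lower bound `(p-1)(d(G)+ε(G)) - 2L(G) + ε(G)` for the radio number. -/
def lbEq (G : SimpleGraph V) : Prop :=
  (rn G : ℤ) =
    ((Fintype.card V : ℤ) - 1) * ((diam G : ℤ) + (eps G : ℤ)) -
      2 * (totalLevel G : ℤ) + (eps G : ℤ)

/-- A lower bound block graph: a block graph whose radio number equals the lower bound. -/
def IsLowerBoundBlockGraph (G : SimpleGraph V) : Prop := IsBlockGraph G ∧ lbEq G

/-- `x` lies on a `(u,v)`-geodesic. -/
def OnGeodesic (G : SimpleGraph V) (x u v : V) : Prop :=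
  G.dist u v = G.dist u x + G.dist x v

/-- `x` is an ancestor of `v` (and `v` a descendent of `x`): `x` lies on the geodesic
from some central vertex to `v`. -/
def IsAncestor (G : SimpleGraph V) (x v : V) : Prop :=
  ∃ w : V, IsCentral G w ∧ OnGeodesic G x w v

/-- `phi G u v`: the maximum level of a common ancestor of `u` and `v`. -/
noncomputable def phi (G : SimpleGraph V) (u v : V) : ℕ :=
  sSup {n | ∃ x, IsAncestor G x u ∧ IsAncestor G x v ∧ level G x = n}

/-- `delta G u v = 1` iff the `(u,v)`-geodesic contains two central vertices. -/
noncomputable def delta (G : SimpleGraph V) (u v : V) : ℕ :=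
  if ∃ x y : V, x ≠ y ∧ IsCentral G x ∧ IsCentral G y ∧
      OnGeodesic G x u v ∧ OnGeodesic G y u v
    then 1 else 0

/-- `rho G u v = 0` iff the `(u,v)`-geodesic contains a central vertex or a common
ancestor of `u` and `v`. -/
noncomputable def rho (G : SimpleGraph V) (u v : V) : ℕ :=
  if ∃ x : V, OnGeodesic G x u v ∧
      (IsCentral G x ∨ (IsAncestor G x u ∧ IsAncestor G x v))
    then 0 else 1

/-- The central block: a block containing at least two weight centers, all of them. -/
def IsCentralBlock (G : SimpleGraph V) (D : Set V) : Prop :=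
  IsBlock G D ∧ 2 ≤ (weightCenters G).ncard ∧ weightCenters G ⊆ D

/-- `v` belongs to the branch of `G` determined by the non-central block `D` adjacent to the
central vertex `w`: `v` is a vertex of `D` other than `w`, or a descendent of such a vertex. -/
def InBranch (G : SimpleGraph V) (w : V) (D : Set V) (v : V) : Prop :=
  IsCentral G w ∧ IsBlock G D ∧ w ∈ D ∧ ¬ IsCentralBlock G D ∧
    ∃ u ∈ D, u ≠ w ∧ IsAncestor G u v

/-- Two vertices are in different branches: branches induced by two different blocks
adjacent to the same central vertex. -/
def DifferentBranches (G : SimpleGraph V) (u v : V) : Prop :=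
  ∃ w D₁ D₂, D₁ ≠ D₂ ∧ InBranch G w D₁ u ∧ InBranch G w D₂ v

/-- Two vertices are in opposite branches: branches induced by blocks adjacent to two
different central vertices. -/
def OppositeBranches (G : SimpleGraph V) (u v : V) : Prop :=
  ∃ w₁ w₂ D₁ D₂, w₁ ≠ w₂ ∧ InBranch G w₁ D₁ u ∧ InBranch G w₂ D₂ v

/-- Two vertices lie in the same branch. -/
def SameBranch (G : SimpleGraph V) (u v : V) : Prop :=
  ∃ w D, InBranch G w D u ∧ InBranch G w D v

noncomputable instance edgeSetFintype (G : SimpleGraph V) : Fintype G.edgeSet :=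
  Set.Finite.fintype (Set.toFinite _)

/-- The set `B(T)` of vertices of the line graph of `T` (i.e. edges of `T`): the vertex `w`
(the unique weight center of the line graph) together with all edges of `T` whose far endpoint
is a descendant, in `T` rooted at its weight center `r`, of the far endpoint of `w`;
equivalently, the edges `e` having an endpoint `x` such that both endpoints of `w` lie on the
`(r,x)`-geodesic in `T`. -/
def edgeDescSet (T : SimpleGraph V) (r : V) (w : T.edgeSet) : Set T.edgeSet :=
  {e | e = w ∨ ∃ x ∈ (e : Sym2 V), ∀ y ∈ (w : Sym2 V), T.dist r x = T.dist r y + T.dist y x}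

/-- Vertices of the `(n,k)`-firecrackers tree: the `n` path vertices (each identified with
a leaf of a star `K_{1,k-1}`), the `n` star centers, and for each star its remaining `k-2`
leaves. -/
abbrev FireVert (n k : ℕ) : Type _ := Fin n ⊕ Fin n ⊕ (Fin n × Fin (k - 2))

/-- Base adjacency relation of the firecrackers tree: consecutive path vertices are
adjacent, each path vertex is adjacent to the center of its star, and each center is
adjacent to the remaining `k-2` leaves of its star. -/
def fireRel (n k : ℕ) : FireVert n k → FireVert n k → Prop := fun u v =>
  match u, v with
  | Sum.inl i, Sum.inl i' => (i : ℕ) + 1 = (i' : ℕ)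
  | Sum.inl i, Sum.inr (Sum.inl i') => i = i'
  | Sum.inr (Sum.inl i), Sum.inr (Sum.inr (i', _)) => i = i'
  | _, _ => False

/-- The `(n,k)`-firecrackers tree `F(n,k)`. -/
def firecrackerTree (n k : ℕ) : SimpleGraph (FireVert n k) := SimpleGraph.fromRel (fireRel n k)

section General

omit [Fintype V] in
theorem connected_and_dist_eq [Nonempty V] {G : SimpleGraph V} (D : V → V → ℕ)
    (hself : ∀ u, D u u = 0) (hadj : ∀ u v w, G.Adj u v → D u w ≤ D v w + 1)
    (hstep : ∀ u v, u ≠ v → ∃ u', G.Adj u u' ∧ D u' v < D u v) :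
    G.Connected ∧ ∀ u v, G.dist u v = D u v := by
  have hlow : ∀ u v (p : G.Walk u v), D u v ≤ p.length := by
    intro u v p
    induction p with
    | nil => simp [hself]
    | cons h p ih =>
      simp only [SimpleGraph.Walk.length_cons]
      exact (hadj _ _ _ h).trans (by omega)
  have hup : ∀ (d : ℕ) (u v : V), D u v ≤ d → ∃ p : G.Walk u v, p.length ≤ d := by
    intro d
    induction d with
    | zero =>
      intro u v h
      by_cases huv : u = v
      · subst huv
        exact ⟨.nil, by simp⟩
      · obtain ⟨u', -, h'⟩ := hstep u v huv
        omega
    | succ d ih =>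
      intro u v h
      by_cases huv : u = v
      · subst huv
        exact ⟨.nil, by simp⟩
      · obtain ⟨u', ha, h'⟩ := hstep u v huv
        obtain ⟨p, hp⟩ := ih u' v (by omega)
        exact ⟨.cons ha p, by simpa using hp⟩
  have hconn : G.Connected :=
    { preconnected := fun u v => (hup _ u v le_rfl).choose.reachable }
  refine ⟨hconn, fun u v => le_antisymm ?_ ?_⟩
  · obtain ⟨p, hp⟩ := hup _ u v le_rfl
    exact (SimpleGraph.dist_le p).trans hp
  · obtain ⟨p, hp⟩ := hconn.exists_walk_length_eq_dist u v
    exact hp ▸ hlow u v p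

omit [Fintype V] in
/-- If any two distinct non-adjacent vertices are separated by a single vertex, then every
2-connected vertex set is a clique. -/
theorem isClique_of_twoConn {G : SimpleGraph V}
    (hsep : ∀ u v, u ≠ v → ¬ G.Adj u v → ∃ (x : V) (A : Set V), u ∈ A ∧ v ∉ A ∧ x ∉ A ∧ v ≠ x ∧
      ∀ a ∈ A, ∀ b ∉ A, G.Adj a b → b = x)
    {S : Set V} (hS : TwoConn G S) : G.IsClique S := by
  intro u hu v hv huv
  by_contra hnadj
  obtain ⟨x, A, huA, hvA, hxA, hvx, hcut⟩ := hsep u v huv hnadj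
  have key : ∀ T : Set V, u ∈ T → v ∈ T → (G.induce T).Connected → x ∈ T := by
    intro T huT hvT hT
    by_contra hxT
    obtain ⟨p⟩ := hT.preconnected ⟨u, huT⟩ ⟨v, hvT⟩
    have : ∀ (a b : T) (_ : (G.induce T).Walk a b), (a : V) ∈ A → (b : V) ∈ A := by
      intro a b q
      induction q with
      | nil => exact id
      | @cons a b c h q ih =>
        intro ha
        apply ih
        by_contra hb
        exact hxT (hcut _ ha _ hb h ▸ b.2)
    exact hvA (this _ _ p huA)
  have hxS := key S hu hv hS.1
  have hux : u ≠ x := fun h => hxA (h ▸ huA)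
  rcases hS.2 x hxS with h | h
  · have : u ∈ S \ {x} := ⟨hu, hux⟩
    rw [h] at this
    exact this
  · exact (key (S \ {x}) ⟨hu, hux⟩ ⟨hv, hvx⟩ h).2 rfl

omit [Fintype V] in
theorem connected_induce_of_isClique {G : SimpleGraph V} {S : Set V} (hS : G.IsClique S)
    (hne : S.Nonempty) : (G.induce S).Connected := by
  have := hne.to_subtype
  refine { preconnected := fun a b => ?_ }
  by_cases hab : a = b
  · exact hab ▸ SimpleGraph.Reachable.refl _
  · exact SimpleGraph.Adj.reachable (hS a.2 b.2 (fun h => hab (Subtype.ext h)))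

omit [Fintype V] in
theorem twoConn_of_isClique {G : SimpleGraph V} {S : Set V} (hS : G.IsClique S)
    (hne : S.Nonempty) : TwoConn G S :=
  ⟨connected_induce_of_isClique hS hne, fun v _ => (S \ {v}).eq_empty_or_nonempty.imp id
    fun h => connected_induce_of_isClique (hS.subset Set.sdiff_subset) h⟩

theorem level_eq {G : SimpleGraph V} {v w : V} (hw : IsCentral G w)
    (hmin : ∀ w', IsCentral G w' → G.dist v w ≤ G.dist v w') : level G v = G.dist v w :=
  le_antisymm (Nat.sInf_le ⟨w, hw, rfl⟩)
    (le_csInf ⟨_, w, hw, rfl⟩ (by rintro _ ⟨w', hw', rfl⟩; exact hmin w' hw'))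

theorem le_span_of_forall_le (f ℓ : V → ℕ) (c e : ℕ) (hcard : 2 ≤ Fintype.card V)
    (hf : ∀ u v, u ≠ v → c ≤ ℓ u + ℓ v + max (f u - f v) (f v - f u))
    (he : ∀ u v, u ≠ v → e ≤ ℓ u + ℓ v) :
    (Fintype.card V - 1) * c + e ≤ span f + 2 * ∑ v, ℓ v := by
  have key : ∀ s : Finset V, s.Nonempty → ∃ a ∈ s, ∃ b ∈ s, (2 ≤ s.card → a ≠ b) ∧
      (∀ x ∈ s, f x ≤ f b) ∧ f a ≤ f b ∧
      s.card * c + ℓ a + ℓ b + f a ≤ c + f b + 2 * ∑ v ∈ s, ℓ v := by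
    intro s
    induction s using Finset.induction_on_max_value f with
    | empty => simp
    | insert x s hxs hmax ih =>
      intro _
      rcases s.eq_empty_or_nonempty with rfl | hne
      · refine ⟨x, by simp, x, by simp, by simp, by simp, le_rfl, ?_⟩
        simp
        omega
      · obtain ⟨a, ha, b, hb, -, -, hab, hsum⟩ := ih hne
        refine ⟨a, by simp [ha], x, by simp, fun _ h => hxs (h ▸ ha), ?_, hmax a ha, ?_⟩
        · simpa using hmax
        · have h1 := hmax b hb
          have h2 := hf x b (fun h => hxs (h ▸ hb))
          rw [Finset.card_insert_of_notMem hxs, Finset.sum_insert hxs, add_mul]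
          omega
  have hne : (Finset.univ : Finset V).Nonempty := by
    rw [← Finset.card_pos, Finset.card_univ]
    omega
  obtain ⟨a, -, b, -, hab, -, -, hsum⟩ := key Finset.univ hne
  have h1 := he a b (hab (by simpa using hcard))
  have h2 : f b - f a ≤ span f :=
    Finset.le_sup (f := fun p : V × V => f p.1 - f p.2) (Finset.mem_univ (b, a))
  rw [Finset.card_univ] at hsum
  have h3 : Fintype.card V * c = (Fintype.card V - 1) * c + c := by
    obtain ⟨q, hq⟩ := Nat.exists_eq_add_of_le' hcard
    rw [hq]
    simp
    ring
  omega

theorem rn_eq {G : SimpleGraph V} {f : V → ℕ} {N : ℕ} (hf : IsRadioLabeling G f)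
    (hN : ∀ v, f v ≤ N) (hlow : ∀ g, IsRadioLabeling G g → N ≤ span g) : rn G = N := by
  have hspan : span f = N := le_antisymm
    (Finset.sup_le fun p _ => (Nat.sub_le _ _).trans (hN p.1)) (hlow f hf)
  exact le_antisymm (Nat.sInf_le ⟨f, hf, hspan⟩)
    (le_csInf ⟨N, f, hf, hspan⟩ (by rintro _ ⟨g, hg, rfl⟩; exact hlow g hg))

theorem diam_eq {G : SimpleGraph V} {d : ℕ} (h : ∀ u v, G.dist u v ≤ d)
    (h' : ∃ u v, G.dist u v = d) : diam G = d := by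
  obtain ⟨u, v, huv⟩ := h'
  exact le_antisymm (Finset.sup_le fun p _ => h p.1 p.2) (huv ▸
    Finset.le_sup (f := fun p : V × V => G.dist p.1 p.2) (Finset.mem_univ (u, v)))

end General

section Coordinates

/-- The edges of the firecrackers tree: path edges, spokes joining the path to the star centers,
and leaf edges. -/
abbrev FireEdge (n k : ℕ) : Type := Fin (n - 1) ⊕ Fin n ⊕ (Fin n × Fin (k - 2))

namespace FireEdge

variable {n k : ℕ}

/-- Twice the horizontal position of (the midpoint of) an edge along the path. -/
def pos : FireEdge n k → ℕ
  | Sum.inl a => 2 * a + 1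
  | Sum.inr (Sum.inl i) => 2 * i
  | Sum.inr (Sum.inr (i, _)) => 2 * i

/-- Twice the vertical displacement of (the midpoint of) an edge from the path. -/
def ht : FireEdge n k → ℕ
  | Sum.inl _ => 0
  | Sum.inr (Sum.inl _) => 1
  | Sum.inr (Sum.inr _) => 3

/-- The index of a leaf edge inside its star. -/
def idx : FireEdge n k → ℕ
  | Sum.inr (Sum.inr (_, j)) => j
  | _ => 0

theorem spec (e : FireEdge n k) :
    (∃ a, ht e = 0 ∧ idx e = 0 ∧ pos e = 2 * a + 1 ∧ a + 1 < n) ∨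
    (∃ i, ht e = 1 ∧ idx e = 0 ∧ pos e = 2 * i ∧ i < n) ∨
    (∃ i, ht e = 3 ∧ idx e < k - 2 ∧ pos e = 2 * i ∧ i < n) := by
  rcases e with a | i | ⟨i, j⟩
  · exact .inl ⟨a, rfl, rfl, rfl, by omega⟩
  · exact .inr (.inl ⟨i, rfl, rfl, rfl, i.2⟩)
  · exact .inr (.inr ⟨i, rfl, j.2, rfl, i.2⟩)

theorem eq_iff (u v : FireEdge n k) : u = v ↔ pos u = pos v ∧ ht u = ht v ∧ idx u = idx v := by
  rcases u with a | i | ⟨i, j⟩ <;> rcases v with b | i' | ⟨i', j'⟩ <;>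
    simp [pos, ht, idx, Fin.ext_iff]

theorem exists_path {a : ℕ} (h : a + 1 < n) :
    ∃ e : FireEdge n k, pos e = 2 * a + 1 ∧ ht e = 0 ∧ idx e = 0 :=
  ⟨.inl ⟨a, by omega⟩, rfl, rfl, rfl⟩

theorem exists_spoke {i : ℕ} (h : i < n) :
    ∃ e : FireEdge n k, pos e = 2 * i ∧ ht e = 1 ∧ idx e = 0 :=
  ⟨.inr (.inl ⟨i, h⟩), rfl, rfl, rfl⟩

theorem exists_leaf {i j : ℕ} (h : i < n) (hj : j < k - 2) :
    ∃ e : FireEdge n k, pos e = 2 * i ∧ ht e = 3 ∧ idx e = j :=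
  ⟨.inr (.inr (⟨i, h⟩, ⟨j, hj⟩)), rfl, rfl, rfl⟩

/-- The distance between two edges in the line graph, in terms of coordinates. -/
noncomputable def edist (u v : FireEdge n k) : ℕ :=
  if pos u = pos v ∧ ht u = ht v ∧ idx u = idx v then 0
  else if pos u = pos v then 1
  else (pos u - pos v + (pos v - pos u) + ht u + ht v) / 2

theorem edist_self (u : FireEdge n k) : edist u u = 0 := by simp [edist]

theorem edist_comm (u v : FireEdge n k) : edist u v = edist v u := by
  unfold edist
  split_ifs <;> omega

theorem ht_cases (u : FireEdge n k) :
    (ht u = 0 ∧ pos u % 2 = 1 ∧ idx u = 0 ∧ pos u + 3 ≤ 2 * n) ∨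
    (ht u = 1 ∧ pos u % 2 = 0 ∧ idx u = 0 ∧ pos u + 2 ≤ 2 * n) ∨
    (ht u = 3 ∧ pos u % 2 = 0 ∧ idx u < k - 2 ∧ pos u + 2 ≤ 2 * n) := by
  rcases spec u with ⟨a, hu⟩ | ⟨a, hu⟩ | ⟨a, hu⟩ <;> omega

theorem edist_spec (u v : FireEdge n k) :
    (pos u = pos v ∧ ht u = ht v ∧ idx u = idx v ∧ edist u v = 0) ∨
    (pos u = pos v ∧ (ht u ≠ ht v ∨ idx u ≠ idx v) ∧ edist u v = 1) ∨
    (pos u < pos v ∧ 2 * edist u v + pos u = pos v + ht u + ht v) ∨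
    (pos v < pos u ∧ 2 * edist u v + pos v = pos u + ht u + ht v) := by
  have hu := ht_cases u
  have hv := ht_cases v
  unfold edist
  split_ifs with h1 h2
  · exact .inl (by omega)
  · exact .inr (.inl (by omega))
  · right; right
    omega

theorem edist_le_of_edist_eq_one (u v w : FireEdge n k) (h : edist u v = 1) :
    edist u w ≤ edist v w + 1 := by
  have hu := ht_cases u
  have hv := ht_cases v
  have hw := ht_cases w
  rcases edist_spec u v with h1 | h1 | h1 | h1
  · omega
  all_goals
    rcases edist_spec u w with h2 | h2 | h2 | h2
    · omega
    · rcases edist_spec v w with h3 | h3 | h3 | h3 <;> omega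
    all_goals
      rcases edist_spec v w with h3 | h3 | h3 | h3 <;> omega

theorem exists_step (u v : FireEdge n k) (h : u ≠ v) :
    ∃ u', edist u u' = 1 ∧ edist u' v < edist u v := by
  rw [ne_eq, eq_iff] at h
  by_cases h1 : edist u v = 1
  · exact ⟨v, h1, by simp [h1, edist_self]⟩
  suffices H : ∃ p h' : ℕ, (∃ e : FireEdge n k, pos e = p ∧ ht e = h' ∧ idx e = 0) ∧
      ∀ e : FireEdge n k, pos e = p ∧ ht e = h' ∧ idx e = 0 →
        edist u e = 1 ∧ edist e v < edist u v by
    obtain ⟨p, h', ⟨e, he⟩, H⟩ := H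
    exact ⟨e, H e he⟩
  have hv := ht_cases v
  have huv := edist_spec u v
  have hne : pos u ≠ pos v := by omega
  rcases spec u with ⟨a, hu⟩ | ⟨a, hu⟩ | ⟨a, hu⟩
  · by_cases hlt : pos u < pos v
    · by_cases h2 : pos v = 2 * (a + 1)
      · refine ⟨2 * (a + 1), 1, exists_spoke (by omega), fun e he => ?_⟩
        have h3 := edist_spec u e
        have h4 := edist_spec e v
        omega
      · refine ⟨2 * (a + 1) + 1, 0, exists_path (by omega), fun e he => ?_⟩
        have h3 := edist_spec u e
        have h4 := edist_spec e v
        omega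
    · by_cases h2 : pos v = 2 * a
      · refine ⟨2 * a, 1, exists_spoke (by omega), fun e he => ?_⟩
        have h3 := edist_spec u e
        have h4 := edist_spec e v
        omega
      · refine ⟨2 * (a - 1) + 1, 0, exists_path (by omega), fun e he => ?_⟩
        have h3 := edist_spec u e
        have h4 := edist_spec e v
        omega
  · by_cases hlt : pos u < pos v
    · refine ⟨2 * a + 1, 0, exists_path (by omega), fun e he => ?_⟩
      have h3 := edist_spec u e
      have h4 := edist_spec e v
      omega
    · refine ⟨2 * (a - 1) + 1, 0, exists_path (by omega), fun e he => ?_⟩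
      have h3 := edist_spec u e
      have h4 := edist_spec e v
      omega
  · refine ⟨2 * a, 1, exists_spoke (by omega), fun e he => ?_⟩
    have h3 := edist_spec u e
    have h4 := edist_spec e v
    omega

theorem edist_triangle (u v w : FireEdge n k) : edist u w ≤ edist u v + edist v w := by
  let H : SimpleGraph (FireEdge n k) :=
    { Adj := fun u v => edist u v = 1
      symm := ⟨fun u v h => (edist_comm v u).trans h⟩
      loopless := ⟨fun u h => by simp [edist_self] at h⟩ }
  have : Nonempty (FireEdge n k) := ⟨u⟩
  obtain ⟨hconn, hdist⟩ := connected_and_dist_eq (G := H) edist edist_self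
    (fun u v w h => edist_le_of_edist_eq_one u v w h) exists_step
  simpa only [hdist] using hconn.dist_triangle (u := u) (v := v) (w := w)

/-- Non-adjacent edges are separated by the removal of a third edge. -/
theorem exists_separation (u v : FireEdge n k) (h : u ≠ v) (h1 : edist u v ≠ 1) :
    ∃ (x : FireEdge n k) (A : Set (FireEdge n k)), u ∈ A ∧ v ∉ A ∧ x ∉ A ∧ v ≠ x ∧
      ∀ a ∈ A, ∀ b ∉ A, edist a b = 1 → b = x := by
  rw [ne_eq, eq_iff] at h
  simp only [ne_eq, eq_iff]
  have hu := ht_cases u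
  have hv := ht_cases v
  have huv := edist_spec u v
  have hne : pos u ≠ pos v := by omega
  by_cases hul : ht u = 3
  · obtain ⟨x, hx⟩ : ∃ e : FireEdge n k, pos e = 2 * (pos u / 2) ∧ ht e = 1 ∧ idx e = 0 :=
      exists_spoke (by omega)
    refine ⟨x, {z | ht z = 3 ∧ pos z = pos u}, ?_⟩
    simp only [Set.mem_ofPred_eq]
    refine ⟨by simpa using hul, by omega, by omega, by omega, fun y hy z hz hyz => ?_⟩
    have hzc := ht_cases z
    have := edist_spec y z
    omega
  by_cases hvl : ht v = 3
  · obtain ⟨x, hx⟩ : ∃ e : FireEdge n k, pos e = 2 * (pos v / 2) ∧ ht e = 1 ∧ idx e = 0 :=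
      exists_spoke (by omega)
    refine ⟨x, {z | pos z ≠ pos v}, ?_⟩
    simp only [Set.mem_ofPred_eq]
    refine ⟨by omega, by omega, by omega, by omega, fun y hy z hz hyz => ?_⟩
    have hyc := ht_cases y
    have hzc := ht_cases z
    have := edist_spec y z
    omega
  by_cases hlt : pos u < pos v
  · obtain ⟨x, hx⟩ : ∃ e : FireEdge n k, pos e = 2 * ((pos u + 1) / 2) + 1 ∧ ht e = 0 ∧ idx e = 0 :=
      exists_path (by omega)
    refine ⟨x, {z | pos z < pos x}, ?_⟩
    simp only [Set.mem_ofPred_eq]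
    refine ⟨by omega, by omega, by omega, by omega, fun y hy z hz hyz => ?_⟩
    have hyc := ht_cases y
    have hzc := ht_cases z
    have := edist_spec y z
    omega
  · obtain ⟨x, hx⟩ : ∃ e : FireEdge n k, pos e = 2 * (pos u / 2 - 1) + 1 ∧ ht e = 0 ∧ idx e = 0 :=
      exists_path (by omega)
    refine ⟨x, {z | pos x < pos z}, ?_⟩
    simp only [Set.mem_ofPred_eq]
    refine ⟨by omega, by omega, by omega, by omega, fun y hy z hz hyz => ?_⟩
    have hyc := ht_cases y
    have hzc := ht_cases z
    have := edist_spec y z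
    omega

end FireEdge

end Coordinates

section Firecracker

variable {n k : ℕ}

/-- The pair of vertices of the firecrackers tree joined by a given edge. -/
def fireSym2 (hn : 3 ≤ n) : FireEdge n k → Sym2 (FireVert n k)
  | Sum.inl a => s(Sum.inl ⟨a, by omega⟩, Sum.inl ⟨a + 1, by omega⟩)
  | Sum.inr (Sum.inl i) => s(Sum.inl i, Sum.inr (Sum.inl i))
  | Sum.inr (Sum.inr (i, j)) => s(Sum.inr (Sum.inl i), Sum.inr (Sum.inr (i, j)))

theorem fireSym2_mem (hn : 3 ≤ n) (e : FireEdge n k) :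
    fireSym2 hn e ∈ (firecrackerTree n k).edgeSet := by
  rcases e with a | i | ⟨i, j⟩ <;>
    simp [fireSym2, firecrackerTree, fireRel, Fin.ext_iff]

theorem fireSym2_injective (hn : 3 ≤ n) : Function.Injective (fireSym2 (k := k) hn) := by
  intro u v
  rcases u with a | i | ⟨i, j⟩ <;> rcases v with b | i' | ⟨i', j'⟩ <;>
    simp [fireSym2, Fin.ext_iff]
  all_goals omega

theorem exists_fireSym2_eq (hn : 3 ≤ n) {x y : FireVert n k} (h : fireRel n k x y) :
    ∃ e, fireSym2 hn e = s(x, y) := by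
  rcases x with i | i | ⟨i, j⟩ <;> rcases y with i' | i' | ⟨i', j'⟩ <;>
    simp only [fireRel] at h
  · exact ⟨.inl ⟨i, by omega⟩, by simp [fireSym2, h]⟩
  · exact ⟨.inr (.inl i), by simp [fireSym2, h]⟩
  · exact ⟨.inr (.inr (i', j')), by simp [fireSym2, h]⟩

/-- The coordinates of the edges of the firecrackers tree. -/
noncomputable def fireEquiv (hn : 3 ≤ n) : FireEdge n k ≃ (firecrackerTree n k).edgeSet :=
  Equiv.ofBijective (fun e => ⟨fireSym2 hn e, fireSym2_mem hn e⟩) <| by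
    refine ⟨fun u v h => fireSym2_injective hn (congrArg Subtype.val h), ?_⟩
    rintro ⟨s, hs⟩
    induction s with
    | h x y =>
      have hs' : x ≠ y ∧ (fireRel n k x y ∨ fireRel n k y x) := hs
      rcases hs'.2 with h | h
      · obtain ⟨e, he⟩ := exists_fireSym2_eq hn h
        exact ⟨e, Subtype.ext he⟩
      · obtain ⟨e, he⟩ := exists_fireSym2_eq hn h
        exact ⟨e, Subtype.ext (he.trans Sym2.eq_swap)⟩

theorem adj_fireEquiv (hn : 3 ≤ n) (u v : FireEdge n k) :
    (SimpleGraph.lineGraph (firecrackerTree n k)).Adj (fireEquiv hn u) (fireEquiv hn v) ↔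
      FireEdge.edist u v = 1 := by
  rw [SimpleGraph.lineGraph_adj_iff_exists, (fireEquiv hn).injective.ne_iff]
  have hex : (∃ x, x ∈ (fireEquiv hn u : Sym2 (FireVert n k)) ∧
      x ∈ (fireEquiv hn v : Sym2 (FireVert n k))) ↔
      ∃ x, x ∈ fireSym2 hn u ∧ x ∈ fireSym2 hn v := Iff.rfl
  rw [hex, ne_eq, FireEdge.eq_iff]
  have hs := FireEdge.edist_spec u v
  generalize FireEdge.edist u v = d at hs ⊢
  rcases u with a | i | ⟨i, j⟩ <;> rcases v with b | i' | ⟨i', j'⟩ <;>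
    simp only [FireEdge.pos, FireEdge.ht, FireEdge.idx] at hs ⊢ <;>
    simp [fireSym2, or_and_right, exists_or, Fin.ext_iff] <;> omega

end Firecracker

section Centers

open FireEdge

variable {n k : ℕ}

/-- The reflection of the firecrackers tree which reverses the path. -/
def reflect (n k : ℕ) : Equiv.Perm (FireEdge n k) :=
  Equiv.sumCongr Fin.revPerm
    (Equiv.sumCongr Fin.revPerm (Equiv.prodCongr Fin.revPerm (Equiv.refl _)))

theorem reflect_spec (e : FireEdge n k) :
    pos (reflect n k e) + pos e = 2 * n - 2 ∧ ht (reflect n k e) = ht e ∧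
      idx (reflect n k e) = idx e := by
  rcases e with a | i | ⟨i, j⟩ <;> simp [reflect, pos, ht, idx, Fin.val_rev] <;> omega

/-- The permutation of the edges exchanging the stars (but not the path edges) at positions
`i` and `j`. -/
noncomputable def swapStars (k : ℕ) (i j : Fin n) : Equiv.Perm (FireEdge n k) :=
  Equiv.sumCongr (Equiv.refl _)
    (Equiv.sumCongr (Equiv.swap i j) (Equiv.prodCongr (Equiv.swap i j) (Equiv.refl _)))

theorem swapStars_spec (i j : Fin n) (e : FireEdge n k) :
    ht (swapStars k i j e) = ht e ∧ idx (swapStars k i j e) = idx e ∧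
    ((ht e = 0 ∧ pos (swapStars k i j e) = pos e) ∨
      (ht e ≠ 0 ∧ pos e = 2 * i ∧ pos (swapStars k i j e) = 2 * j) ∨
      (ht e ≠ 0 ∧ pos e = 2 * j ∧ pos (swapStars k i j e) = 2 * i) ∨
      (ht e ≠ 0 ∧ pos e ≠ 2 * i ∧ pos e ≠ 2 * j ∧ pos (swapStars k i j e) = pos e)) := by
  rcases e with a | l | ⟨l, j'⟩
  · simp [swapStars, pos, ht, idx]
  all_goals
    rcases eq_or_ne l i with rfl | hi
    · simp [swapStars, pos, ht, idx]
    · rcases eq_or_ne l j with rfl | hj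
      · simp [swapStars, pos, ht, idx]
      · have := Fin.val_ne_of_ne hi
        have := Fin.val_ne_of_ne hj
        simp [swapStars, pos, ht, idx, Equiv.swap_apply_of_ne_of_ne hi hj]
        omega

theorem sum_lt_sum_of_perm {ι : Type*} [Fintype ι] (π : Equiv.Perm ι) (f g : ι → ℕ)
    (h : ∀ u, f u + f (π u) ≤ g u + g (π u)) (v : ι) (hv : f v + f (π v) < g v + g (π v)) :
    ∑ u, f u < ∑ u, g u := by
  have h1 := Finset.sum_lt_sum (fun u (_ : u ∈ Finset.univ) => h u) ⟨v, Finset.mem_univ v, hv⟩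
  rw [Finset.sum_add_distrib, Finset.sum_add_distrib, Equiv.sum_comp π f, Equiv.sum_comp π g] at h1
  omega

theorem sum_edist_lt_of_even {m : ℕ} (hnm : n = 2 * m) (w x : FireEdge n k)
    (hw : pos w + 1 = n) (hx : x ≠ w) : ∑ u, edist u w < ∑ u, edist u x := by
  have hwc := ht_cases w
  have hxc := ht_cases x
  rw [ne_eq, eq_iff] at hx
  refine sum_lt_sum_of_perm (reflect n k) _ _ (fun u => ?_) w ?_
  · have hσ := reflect_spec u
    have huc := ht_cases u
    have h1 := edist_spec u w
    have h2 := edist_spec (reflect n k u) w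
    have h3 := edist_spec u (reflect n k u)
    have h4 := edist_triangle u x (reflect n k u)
    rw [edist_comm x] at h4
    refine le_trans ?_ h4
    omega
  · have hσ := reflect_spec w
    have h1 := edist_spec w w
    have h2 := edist_spec (reflect n k w) w
    have h3 := edist_spec w x
    have h4 := edist_spec (reflect n k w) x
    omega

theorem edist_add_edist_reflect_le {m : ℕ} (hnm : n = 2 * m + 1) (b u : FireEdge n k)
    (hb : pos b = n) (hu : pos u ≠ 2 * m) :
    edist u b + edist (reflect n k u) b ≤ edist u (reflect n k u) := by
  have hbc := ht_cases b
  have hσ := reflect_spec u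
  have huc := ht_cases u
  have h1 := edist_spec u b
  have h2 := edist_spec (reflect n k u) b
  have h3 := edist_spec u (reflect n k u)
  generalize edist u b = d1 at *
  generalize edist (reflect n k u) b = d2 at *
  generalize edist u (reflect n k u) = d3 at *
  have hb0 : ht b = 0 := by omega
  rcases lt_or_gt_of_ne hu with hu | hu
  · rw [or_iff_right (by omega), or_iff_right (by omega), or_iff_left (by omega)] at h1 h3
    rcases h2 with h2 | h2 | h2 | h2 <;> omega
  · rw [or_iff_right (by omega), or_iff_right (by omega)] at h3
    rw [or_iff_right (by omega), or_iff_right (by omega)] at h2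
    rcases h1 with h1 | h1 | h1 | h1 <;> omega

theorem sum_edist_lt_of_odd {m : ℕ} (hnm : n = 2 * m + 1) (hm : 1 ≤ m) (b x : FireEdge n k)
    (hb : pos b = n) (hx : x ≠ b) (hx' : pos x + 2 ≠ n) :
    ∑ u, edist u b < ∑ u, edist u x := by
  have hbc := ht_cases b
  have hxc := ht_cases x
  rw [ne_eq, eq_iff] at hx
  by_cases hmid : pos x = 2 * m
  · obtain ⟨π, hπ⟩ : ∃ π, π = swapStars k (⟨m, by omega⟩ : Fin n) ⟨2 * m, by omega⟩ := ⟨_, rfl⟩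
    have hs := swapStars_spec (k := k) (⟨m, by omega⟩ : Fin n) ⟨2 * m, by omega⟩
    rw [← hπ] at hs
    simp only at hs
    refine sum_lt_sum_of_perm π _ _ (fun u => ?_) b ?_
    · have hσ := hs u
      have huc := ht_cases u
      have h1 := edist_spec u b
      have h2 := edist_spec (π u) b
      have h3 := edist_spec u x
      have h4 := edist_spec (π u) x
      generalize edist u b = d1 at *
      generalize edist u x = d2 at *
      generalize edist (π u) b = d3 at *
      generalize edist (π u) x = d4 at *
      clear hs hπ
      rcases hσ with ⟨e1, e2, hσ | hσ | hσ | hσ⟩ <;>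
      rcases h1 with h1 | h1 | h1 | h1 <;> omega
    · have hσ := hs b
      have h1 := edist_spec b b
      have h2 := edist_spec (π b) b
      have h3 := edist_spec b x
      have h4 := edist_spec (π b) x
      omega
  · obtain ⟨s, hs⟩ : ∃ e : FireEdge n k, pos e = 2 * m ∧ ht e = 1 ∧ idx e = 0 :=
      exists_spoke (by omega)
    refine sum_lt_sum_of_perm (reflect n k) _ _ (fun u => ?_) s ?_
    · have hσ := reflect_spec u
      have huc := ht_cases u
      by_cases hu : pos u = 2 * m
      · have hσu : reflect n k u = u := (eq_iff _ _).2 (by omega)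
        rw [hσu]
        have h1 := edist_spec u b
        have h3 := edist_spec u x
        omega
      · have h4 := edist_triangle u x (reflect n k u)
        rw [edist_comm x] at h4
        exact (edist_add_edist_reflect_le hnm b u hb hu).trans h4
    · have hσ := reflect_spec s
      have h1 := edist_spec s b
      have h2 := edist_spec (reflect n k s) b
      have h3 := edist_spec s x
      have h4 := edist_spec (reflect n k s) x
      omega

theorem sum_edist_eq_of_odd (a b : FireEdge n k) (ha : pos a + 2 = n)
    (hb : pos b = n) (hha : ht a = 0) (hhb : ht b = 0) : ∑ u, edist u a = ∑ u, edist u b := by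
  rw [← Equiv.sum_comp (reflect n k)]
  refine Finset.sum_congr rfl fun u _ => ?_
  have hσ := reflect_spec u
  have hac := ht_cases a
  have hbc := ht_cases b
  have h1 := edist_spec u b
  have h2 := edist_spec (reflect n k u) a
  omega

end Centers

section Coordinatization

open FireEdge

variable {n k : ℕ} {G : SimpleGraph V} (c : FireEdge n k ≃ V)

omit [Fintype V] in
theorem connected_and_dist_eq_edist (hn : 3 ≤ n)
    (hadj : ∀ u v, G.Adj (c u) (c v) ↔ edist u v = 1) :
    G.Connected ∧ ∀ u v, G.dist (c u) (c v) = edist u v := by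
  have : Nonempty V := ⟨c (.inr (.inl ⟨0, by omega⟩))⟩
  have h := connected_and_dist_eq (G := G) (fun u v => edist (c.symm u) (c.symm v))
    (fun u => edist_self _)
    (fun u v w huv => edist_le_of_edist_eq_one _ _ _ (by simpa using (hadj (c.symm u) (c.symm v)).1 (by simpa using huv)))
    (fun u v huv => by
      obtain ⟨u', h1, h2⟩ := exists_step (c.symm u) (c.symm v) (by simpa using huv)
      exact ⟨c u', by simpa using (hadj (c.symm u) u').2 h1, by simpa using h2⟩)
  exact ⟨h.1, fun u v => by simp [h.2]⟩

omit [Fintype V] in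
theorem isClique_of_twoConn_of_coords (hadj : ∀ u v, G.Adj (c u) (c v) ↔ edist u v = 1)
    {S : Set V} (hS : TwoConn G S) : G.IsClique S := by
  refine isClique_of_twoConn (fun u v huv hnadj => ?_) hS
  obtain ⟨u, rfl⟩ := c.surjective u
  obtain ⟨v, rfl⟩ := c.surjective v
  obtain ⟨x, A, h1, h2, h3, h4, h5⟩ := exists_separation u v (fun h => huv (h ▸ rfl))
    (fun h => hnadj ((hadj u v).2 h))
  refine ⟨c x, c.symm ⁻¹' A, by simpa, by simpa, by simpa, by simpa, fun a ha b hb hab => ?_⟩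
  have := h5 _ ha _ hb ((hadj _ _).1 (by simpa using hab))
  rw [← this, c.apply_symm_apply]

theorem diam_eq_of_coords (hn : 3 ≤ n) (hk : 3 ≤ k)
    (hdist : ∀ u v, G.dist (c u) (c v) = edist u v) : diam G = n + 2 := by
  refine diam_eq (fun u v => ?_) ?_
  · obtain ⟨u, rfl⟩ := c.surjective u
    obtain ⟨v, rfl⟩ := c.surjective v
    rw [hdist]
    have hu := ht_cases u
    have hv := ht_cases v
    have := edist_spec u v
    omega
  · obtain ⟨u, hu⟩ := exists_leaf (n := n) (k := k) (i := 0) (j := 0) (by omega) (by omega)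
    obtain ⟨v, hv⟩ := exists_leaf (n := n) (k := k) (i := n - 1) (j := 0) (by omega) (by omega)
    refine ⟨c u, c v, ?_⟩
    rw [hdist]
    have := edist_spec u v
    omega

theorem wt_eq_of_coords (hdist : ∀ u v, G.dist (c u) (c v) = edist u v) (x : FireEdge n k) :
    wt G (c x) = ∑ u, edist u x := by
  rw [wt, ← Equiv.sum_comp c]
  simp [hdist]

/-- Twice the distance from the middle of the firecrackers tree. -/
def midDist (e : FireEdge n k) : ℕ := (pos e - (n - 1)) + (n - 1 - pos e) + ht e

theorem weightCenters_of_even (hn : 3 ≤ n) {m : ℕ} (hnm : n = 2 * m)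
    (hdist : ∀ u v, G.dist (c u) (c v) = edist u v) :
    ∃ w, pos w + 1 = n ∧ weightCenters G = {c w} := by
  obtain ⟨w, hw⟩ := exists_path (n := n) (k := k) (a := m - 1) (by omega)
  refine ⟨w, by omega, ?_⟩
  have hlt : ∀ x, x ≠ w → wt G (c w) < wt G (c x) := fun x hx => by
    rw [wt_eq_of_coords c hdist, wt_eq_of_coords c hdist]
    exact sum_edist_lt_of_even hnm w x (by omega) hx
  ext v
  obtain ⟨x, rfl⟩ := c.surjective v
  simp only [weightCenters, Set.mem_ofPred_eq, Set.mem_singleton_iff, c.apply_eq_iff_eq]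
  constructor
  · intro h
    by_contra hx
    exact absurd (h (c w)) (not_le.2 (hlt x hx))
  · rintro rfl u
    obtain ⟨y, rfl⟩ := c.surjective u
    by_cases hy : y = x
    · rw [hy]
    · exact (hlt y hy).le

theorem eps_and_level_of_even (hn : 3 ≤ n) {m : ℕ} (hnm : n = 2 * m)
    (hdist : ∀ u v, G.dist (c u) (c v) = edist u v) :
    eps G = 1 ∧ ∀ e, 2 * level G (c e) = midDist e := by
  obtain ⟨w, hw, hW⟩ := weightCenters_of_even c hn hnm hdist
  refine ⟨by simp [eps, hW], fun e => ?_⟩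
  have hcent : ∀ v, IsCentral G v ↔ v = c w := by
    intro v
    rw [IsCentral, hW, Set.ncard_singleton]
    simp [eq_comm]
  rw [level_eq ((hcent _).2 rfl) (fun w' hw' => by rw [(hcent _).1 hw']), hdist, midDist]
  have hwc := ht_cases w
  have hec := ht_cases e
  have := edist_spec e w
  omega

theorem weightCenters_of_odd {m : ℕ} (hnm : n = 2 * m + 1) (hm : 1 ≤ m)
    (hdist : ∀ u v, G.dist (c u) (c v) = edist u v) (a b : FireEdge n k)
    (ha : pos a + 2 = n) (hb : pos b = n) : weightCenters G = {c a, c b} := by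
  have hac := ht_cases a
  have hbc := ht_cases b
  have heq : wt G (c a) = wt G (c b) := by
    rw [wt_eq_of_coords c hdist, wt_eq_of_coords c hdist]
    exact sum_edist_eq_of_odd a b ha hb (by omega) (by omega)
  have hlt : ∀ x, x ≠ a → x ≠ b → wt G (c b) < wt G (c x) := fun x hxa hxb => by
    have hxc := ht_cases x
    rw [wt_eq_of_coords c hdist, wt_eq_of_coords c hdist]
    refine sum_edist_lt_of_odd hnm hm b x hb hxb (fun h => hxa ?_)
    exact (eq_iff _ _).2 (by omega)
  have hle : ∀ x, wt G (c b) ≤ wt G (c x) := fun x => by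
    by_cases hxa : x = a
    · rw [hxa, heq]
    by_cases hxb : x = b
    · rw [hxb]
    exact (hlt x hxa hxb).le
  ext v
  obtain ⟨x, rfl⟩ := c.surjective v
  simp only [weightCenters, Set.mem_ofPred_eq, Set.mem_singleton_iff, Set.mem_insert_iff,
    c.apply_eq_iff_eq]
  constructor
  · intro h
    by_contra! hx
    exact absurd (h (c b)) (not_le.2 (hlt x hx.1 hx.2))
  · intro h u
    obtain ⟨y, rfl⟩ := c.surjective u
    rcases h with rfl | rfl
    · exact heq ▸ hle y
    · exact hle y

theorem eq_of_edist_eq_one (a b s x : FireEdge n k) (hab : pos a + 2 = pos b ∧ ht a = 0 ∧ ht b = 0)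
    (hs : pos s + 1 = pos b ∧ ht s = 1) (ha : edist x a = 1) (hb : edist x b = 1) : x = s := by
  have hac := ht_cases a
  have hbc := ht_cases b
  have hsc := ht_cases s
  have hxc := ht_cases x
  have hpos : pos x = pos s ∧ ht x = 1 := by
    rcases edist_spec x a with h | h | h | h
    · omega
    · rcases edist_spec x b with h' | h' | h' | h' <;> omega
    · rcases edist_spec x b with h' | h' | h' | h' <;> omega
    · rcases edist_spec x b with h' | h' | h' | h' <;> omega
  exact (eq_iff _ _).2 (by omega)

theorem isCentral_iff_of_odd {m : ℕ} (hnm : n = 2 * m + 1)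
    (hadj : ∀ u v, G.Adj (c u) (c v) ↔ edist u v = 1) (a b s : FireEdge n k)
    (ha : pos a + 2 = n) (hb : pos b = n) (hs : pos s + 1 = n ∧ ht s = 1)
    (hW : weightCenters G = {c a, c b}) (v : V) :
    IsCentral G v ↔ v = c a ∨ v = c b ∨ v = c s := by
  have hac := ht_cases a
  have hbc := ht_cases b
  have hsc := ht_cases s
  have hab : a ≠ b := by
    rintro rfl
    omega
  have hcab : c a ≠ c b := c.injective.ne hab
  have hcard : (weightCenters G).ncard = 2 := by rw [hW, Set.ncard_pair hcab]
  have hsub : ∀ T : Set V, G.IsClique T → {c a, c b} ⊆ T → T ⊆ {c a, c b, c s} := by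
    intro T hT hab v hv
    obtain ⟨x, rfl⟩ := c.surjective v
    by_cases hxa : x = a
    · simp [hxa]
    by_cases hxb : x = b
    · simp [hxb]
    have h1 := (hadj _ _).1 (hT hv (hab (by simp)) (c.injective.ne hxa))
    have h2 := (hadj _ _).1 (hT hv (hab (by simp)) (c.injective.ne hxb))
    have hxs : x = s := eq_of_edist_eq_one a b s x (by omega) (by omega) h1 h2
    simp [hxs]
  have htri : G.IsClique {c a, c b, c s} := by
    have h1 : G.Adj (c a) (c b) := (hadj _ _).2 (by have := edist_spec a b; omega)
    have h2 : G.Adj (c a) (c s) := (hadj _ _).2 (by have := edist_spec a s; omega)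
    have h3 : G.Adj (c b) (c s) := (hadj _ _).2 (by have := edist_spec b s; omega)
    intro x hx y hy hxy
    rcases hx with rfl | rfl | rfl <;> rcases hy with rfl | rfl | rfl
    exacts [absurd rfl hxy, h1, h2, h1.symm, absurd rfl hxy, h3, h2.symm, h3.symm, absurd rfl hxy]
  have htwo : TwoConn G {c a, c b, c s} := twoConn_of_isClique htri ⟨c a, by simp⟩
  have hpair : ({c a, c b} : Set V) ⊆ {c a, c b, c s} := by
    rintro x (rfl | rfl) <;> simp
  rw [IsCentral]
  constructor
  · rintro (h | ⟨-, S, hS, hWS, hv⟩)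
    · rw [h, Set.ncard_singleton] at hcard
      omega
    · rw [hW] at hWS
      exact hsub S (isClique_of_twoConn_of_coords c hadj hS.1) hWS hv
  · intro hv
    refine .inr ⟨hcard.ge, {c a, c b, c s}, ⟨htwo, fun T hT hT' => ?_⟩, hW ▸ hpair, hv⟩
    exact (hsub T (isClique_of_twoConn_of_coords c hadj hT') (hpair.trans hT)).antisymm hT

theorem eps_and_level_of_odd {m : ℕ} (hnm : n = 2 * m + 1) (hm : 1 ≤ m)
    (hadj : ∀ u v, G.Adj (c u) (c v) ↔ edist u v = 1)
    (hdist : ∀ u v, G.dist (c u) (c v) = edist u v) :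
    eps G = 0 ∧ ∀ e, 2 * level G (c e) + 1 = midDist e := by
  obtain ⟨a, ha⟩ := exists_path (n := n) (k := k) (a := m - 1) (by omega)
  obtain ⟨b, hb⟩ := exists_path (n := n) (k := k) (a := m) (by omega)
  obtain ⟨s, hs⟩ := exists_spoke (n := n) (k := k) (i := m) (by omega)
  have hab : a ≠ b := by
    rintro rfl
    omega
  have hW := weightCenters_of_odd c hnm hm hdist a b (by omega) (by omega)
  have hcent := isCentral_iff_of_odd c hnm hadj a b s (by omega) (by omega) (by omega) hW
  refine ⟨by simp [eps, hW, Set.ncard_pair (c.injective.ne hab)], fun e => ?_⟩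
  have hec := ht_cases e
  have hea := edist_spec e a
  have heb := edist_spec e b
  have hes := edist_spec e s
  obtain ⟨w, hw, hmin, hval⟩ : ∃ w, (w = a ∨ w = b ∨ w = s) ∧
      (edist e w ≤ edist e a ∧ edist e w ≤ edist e b ∧ edist e w ≤ edist e s) ∧
      2 * edist e w + 1 = midDist e := by
    unfold midDist
    rcases lt_trichotomy (pos e) (2 * m) with h | h | h
    · exact ⟨a, .inl rfl, by omega, by omega⟩
    · exact ⟨s, .inr (.inr rfl), by omega, by omega⟩
    · exact ⟨b, .inr (.inl rfl), by omega, by omega⟩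
  have hwc : IsCentral G (c w) := by
    rw [hcent]
    rcases hw with rfl | rfl | rfl <;> simp
  rw [level_eq hwc, hdist, hval]
  intro w' hw'
  rcases (hcent _).1 hw' with rfl | rfl | rfl <;> simp only [hdist] <;> omega

end Coordinatization

section TotalLevel

open FireEdge Finset

theorem sum_range_two_mul_dist (m : ℕ) :
    ∑ i ∈ range (2 * m), ((2 * i - (2 * m - 1)) + (2 * m - 1 - 2 * i)) = 2 * m ^ 2 := by
  induction m with
  | zero => simp
  | succ m ih =>
    have h : ∑ i ∈ range (2 * m), ((2 * (i + 1) - (2 * (m + 1) - 1)) +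
        (2 * (m + 1) - 1 - 2 * (i + 1))) = 2 * m ^ 2 := by
      rw [← ih]
      refine sum_congr rfl fun i hi => ?_
      rw [mem_range] at hi
      omega
    rw [show 2 * (m + 1) = 2 * m + 1 + 1 by ring, sum_range_succ, sum_range_succ',
      ← show 2 * (m + 1) = 2 * m + 1 + 1 by ring, h,
      show 2 * (m + 1) ^ 2 = 2 * m ^ 2 + (4 * m + 2) by ring]
    omega

theorem sum_range_two_mul_add_one_dist (m : ℕ) :
    ∑ i ∈ range (2 * m + 1), ((2 * i - 2 * m) + (2 * m - 2 * i)) = 2 * m ^ 2 + 2 * m := by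
  induction m with
  | zero => simp
  | succ m ih =>
    have h : ∑ i ∈ range (2 * m + 1), ((2 * (i + 1) - 2 * (m + 1)) +
        (2 * (m + 1) - 2 * (i + 1))) = 2 * m ^ 2 + 2 * m := by
      rw [← ih]
      refine sum_congr rfl fun i hi => ?_
      rw [mem_range] at hi
      omega
    rw [show 2 * (m + 1) + 1 = 2 * m + 1 + 1 + 1 by ring, sum_range_succ, sum_range_succ', h,
      show 2 * (m + 1) ^ 2 = 2 * m ^ 2 + (4 * m + 2) by ring]
    omega

variable {n k : ℕ}

theorem sum_midDist : ∑ e : FireEdge n k, midDist e =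
    ∑ i ∈ range (n - 1), ((2 * i - (n - 1 - 1)) + (n - 1 - 1 - 2 * i)) +
    (∑ i ∈ range n, ((2 * i - (n - 1)) + (n - 1 - 2 * i)) + n +
      (k - 2) * (∑ i ∈ range n, ((2 * i - (n - 1)) + (n - 1 - 2 * i)) + 3 * n)) := by
  have h := Fin.sum_univ_eq_sum_range (fun i => (2 * i - (n - 1)) + (n - 1 - 2 * i)) n
  have h' := Fin.sum_univ_eq_sum_range
    (fun i => (2 * i - (n - 1 - 1)) + (n - 1 - 1 - 2 * i)) (n - 1)
  rw [Fintype.sum_sum_type, Fintype.sum_sum_type, Fintype.sum_prod_type, ← h, ← h']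
  congr 1
  · exact sum_congr rfl fun a _ => by simp only [midDist, pos, ht]; omega
  congr 1
  · simp [midDist, pos, ht, sum_add_distrib]
  · simp only [midDist, pos, ht, sum_const, card_univ, Fintype.card_fin, smul_eq_mul]
    rw [← mul_sum, sum_add_distrib]
    simp [mul_comm]

theorem card_fireEdge_add_one (hn : 1 ≤ n) (hk : 2 ≤ k) :
    Fintype.card (FireEdge n k) + 1 = n * k := by
  obtain ⟨k, rfl⟩ := Nat.exists_eq_add_of_le' hk
  obtain ⟨n, rfl⟩ := Nat.exists_eq_add_of_le' hn
  simp only [Fintype.card_sum, Fintype.card_prod, Fintype.card_fin, Nat.add_sub_cancel]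
  ring

theorem sum_midDist_of_even {m : ℕ} (hm : 1 ≤ m) (hnm : n = 2 * m) (hk : 2 ≤ k) :
    ∑ e : FireEdge n k, midDist e + 12 * m = 2 * k * m ^ 2 + 6 * k * m := by
  obtain ⟨k, rfl⟩ := Nat.exists_eq_add_of_le' hk
  obtain ⟨m, rfl⟩ := Nat.exists_eq_add_of_le' hm
  subst hnm
  rw [sum_midDist, sum_range_two_mul_dist,
    show 2 * (m + 1) - 1 = 2 * m + 1 by omega, Nat.add_sub_cancel, sum_range_two_mul_add_one_dist]
  rw [Nat.add_sub_cancel]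
  ring

theorem sum_midDist_of_odd {m : ℕ} (hnm : n = 2 * m + 1) (hk : 2 ≤ k) :
    ∑ e : FireEdge n k, midDist e + 12 * m + 5 = 2 * k * m ^ 2 + 8 * k * m + 3 * k := by
  obtain ⟨k, rfl⟩ := Nat.exists_eq_add_of_le' hk
  subst hnm
  rw [sum_midDist, Nat.add_sub_cancel, sum_range_two_mul_add_one_dist, sum_range_two_mul_dist,
    Nat.add_sub_cancel]
  ring

theorem two_mul_edist_le (u v : FireEdge n k) : 2 * edist u v ≤ midDist u + midDist v := by
  have hu := ht_cases u
  have hv := ht_cases v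
  unfold midDist
  rcases edist_spec u v with h | h | h | h <;> omega

theorem one_le_midDist_add_midDist (u v : FireEdge n k) (h : u ≠ v) :
    1 ≤ midDist u + midDist v := by
  have hu := ht_cases u
  have hv := ht_cases v
  rw [ne_eq, eq_iff] at h
  unfold midDist
  omega

variable {G : SimpleGraph V} (c : FireEdge n k ≃ V)

/-- A labeling attaining the lower bound determines the radio number. -/
theorem rn_eq_and_lbEq (hn : 3 ≤ n) (hk : 3 ≤ k)
    (hdist : ∀ u v, G.dist (c u) (c v) = edist u v) {δ N : ℕ} (hε : eps G + δ = 1)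
    (hlevel : ∀ e, 2 * level G (c e) + δ = midDist e) (f : FireEdge n k → ℕ)
    (hf : ∀ u v, u ≠ v → n + 3 ≤ edist u v + max (f u - f v) (f v - f u)) (hN : ∀ u, f u ≤ N)
    (hNsum : N + ∑ e : FireEdge n k, midDist e + 2 * (n + 2 + eps G) =
      n * k * (n + 2 + eps G) + eps G + δ * (n * k - 1)) :
    rn G = N ∧ lbEq G := by
  have hdiam := diam_eq_of_coords c hn hk hdist
  have hcard : Fintype.card V + 1 = n * k := by
    rw [← Fintype.card_congr c, card_fireEdge_add_one (by omega) (by omega)]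
  have hnk : 9 ≤ n * k := Nat.mul_le_mul hn hk
  have htotal : 2 * totalLevel G + δ * (n * k - 1) = ∑ e : FireEdge n k, midDist e := by
    rw [totalLevel, ← Equiv.sum_comp c, ← sum_congr rfl fun e _ => hlevel e, sum_add_distrib,
      mul_sum, sum_const, card_univ, smul_eq_mul, mul_comm δ, ← hcard, ← Fintype.card_congr c,
      Nat.add_sub_cancel]
  have hsum : N + 2 * totalLevel G = (Fintype.card V - 1) * (n + 2 + eps G) + eps G := by
    have h : n * k * (n + 2 + eps G) =
        (Fintype.card V - 1) * (n + 2 + eps G) + 2 * (n + 2 + eps G) := by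
      rw [← add_mul]
      congr 1
      omega
    omega
  have hrn : rn G = N := by
    refine rn_eq (f := fun v => f (c.symm v)) (fun u v huv => ?_) (fun v => hN _) (fun g hg => ?_)
    · obtain ⟨u, rfl⟩ := c.surjective u
      obtain ⟨v, rfl⟩ := c.surjective v
      rw [hdiam, hdist]
      simp only [c.symm_apply_apply]
      exact hf u v (fun h => huv (h ▸ rfl))
    · have h := le_span_of_forall_le g (level G) (n + 2 + eps G) (eps G) (by omega)
        (fun u v huv => ?_) (fun u v huv => ?_)
      · rw [← totalLevel] at h
        omega
      all_goals
        have h := hg u v huv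
        obtain ⟨u, rfl⟩ := c.surjective u
        obtain ⟨v, rfl⟩ := c.surjective v
        rw [hdiam, hdist] at h
        have hu := hlevel u
        have hv := hlevel v
      · have := two_mul_edist_le u v
        omega
      · have := one_le_midDist_add_midDist u v (fun h => huv (h ▸ rfl))
        omega
  refine ⟨hrn, ?_⟩
  rw [lbEq, hrn, hdiam]
  zify [show 1 ≤ Fintype.card V by omega] at hsum
  push_cast
  linarith

end TotalLevel

section Labelings

open FireEdge

variable {n k : ℕ}

theorem mul_trichotomy (x y z : ℕ) :
    x < y ∧ x * z + z ≤ y * z ∨ x = y ∧ x * z = y * z ∨ y < x ∧ y * z + z ≤ x * z := by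
  rcases lt_trichotomy x y with h | h | h
  · exact .inl ⟨h, by simpa [add_mul] using Nat.mul_le_mul_right z h⟩
  · exact .inr (.inl ⟨h, h ▸ rfl⟩)
  · exact .inr (.inr ⟨h, by simpa [add_mul] using Nat.mul_le_mul_right z h⟩)

theorem mul_add_mul_le {x c y : ℕ} (z : ℕ) (h : x + c ≤ y) : x * z + c * z ≤ y * z := by
  simpa [add_mul] using Nat.mul_le_mul_right z h

theorem mul_add_le_of_lt {x y : ℕ} (z : ℕ) (h : x < y) : x * z + z ≤ y * z := by
  simpa [add_mul] using Nat.mul_le_mul_right z h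

/-- An optimal radio labeling of the line graph of the firecrackers tree with `n = 2 * m`. -/
def evenLabel (m : ℕ) : FireEdge n k → ℕ
  | .inl a =>
    if (a : ℕ) + 1 = m then 0
    else 5 * m + 4 + (k - 2) * (2 * (m * m)) + 2 * (m * m) +
      if (a : ℕ) < m then 2 * (a * m) + 5 * a
      else if (a : ℕ) = m then 2 * (m * m) + 3 * m - 9
      else 2 * ((a - (m + 1)) * m) + 5 * (a - (m + 1)) + m + 2
  | .inr (.inl i) =>
    m + 3 + (k - 2) * (2 * (m * m)) +
      if (i : ℕ) < m then 2 * (i * m) + 5 * i else 2 * ((i - m) * m) + 5 * (i - m) + m + 2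
  | .inr (.inr (i, j)) =>
    m + 2 + j * (2 * (m * m)) +
      if (i : ℕ) < m then 2 * (i * m) + i else 2 * ((i - m) * m) + (i - m) + m

theorem evenLabel_spec {m : ℕ} (hm : 2 ≤ m) (hnm : n = 2 * m) (e : FireEdge n k) :
    ∃ r, (r < m ∧ r * m + m ≤ m * m) ∧
      ((ht e = 0 ∧ idx e = 0 ∧ pos e + 1 = 2 * m ∧ evenLabel m e = 0) ∨
      (ht e = 0 ∧ idx e = 0 ∧ pos e = 2 * m + 1 ∧ evenLabel m e + 9 =
        5 * m + 4 + (k - 2) * (2 * (m * m)) + 2 * (m * m) + 2 * (m * m) + 3 * m) ∨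
      (ht e = 0 ∧ idx e = 0 ∧ pos e = 2 * r + 1 ∧ r + 2 ≤ m ∧ r * m + 2 * m ≤ m * m ∧ evenLabel m e =
        5 * m + 4 + (k - 2) * (2 * (m * m)) + 2 * (m * m) + 2 * (r * m) + 5 * r) ∨
      (ht e = 0 ∧ idx e = 0 ∧ pos e = 2 * (m + 1 + r) + 1 ∧ r + 3 ≤ m ∧ r * m + 3 * m ≤ m * m ∧
        evenLabel m e =
        5 * m + 4 + (k - 2) * (2 * (m * m)) + 2 * (m * m) + 2 * (r * m) + 5 * r + m + 2) ∨
      (ht e = 1 ∧ idx e = 0 ∧ pos e = 2 * r ∧ evenLabel m e =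
        m + 3 + (k - 2) * (2 * (m * m)) + 2 * (r * m) + 5 * r) ∨
      (ht e = 1 ∧ idx e = 0 ∧ pos e = 2 * (m + r) ∧ evenLabel m e =
        m + 3 + (k - 2) * (2 * (m * m)) + 2 * (r * m) + 5 * r + m + 2) ∨
      (ht e = 3 ∧ pos e = 2 * r ∧
        idx e * (2 * (m * m)) + 2 * (m * m) ≤ (k - 2) * (2 * (m * m)) ∧ evenLabel m e =
        m + 2 + idx e * (2 * (m * m)) + 2 * (r * m) + r) ∨
      (ht e = 3 ∧ pos e = 2 * (m + r) ∧
        idx e * (2 * (m * m)) + 2 * (m * m) ≤ (k - 2) * (2 * (m * m)) ∧ evenLabel m e =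
        m + 2 + idx e * (2 * (m * m)) + 2 * (r * m) + r + m)) := by
  have hbound : ∀ r, r < m → r < m ∧ r * m + m ≤ m * m := fun r h => ⟨h, mul_add_le_of_lt m h⟩
  rcases e with a | i | ⟨i, j⟩
  · have ha := a.2
    by_cases h1 : (a : ℕ) + 1 = m
    · exact ⟨0, hbound _ (by omega), .inl ⟨rfl, rfl, by simp only [pos]; omega, by
        simp [evenLabel, h1]⟩⟩
    by_cases h2 : (a : ℕ) = m
    · refine ⟨0, hbound _ (by omega), .inr <| .inl ⟨rfl, rfl, by simp only [pos]; omega, ?_⟩⟩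
      have hmm := Nat.mul_le_mul_right m hm
      simp only [evenLabel, h2, lt_irrefl, if_false, if_true, Nat.add_eq_left, one_ne_zero]
      omega
    by_cases h3 : (a : ℕ) < m
    · exact ⟨a, hbound _ h3, .inr <| .inr <| .inl ⟨rfl, rfl, rfl, by omega,
        mul_add_mul_le m (by omega), by simp [evenLabel, h1, h3, add_assoc]⟩⟩
    · exact ⟨a - (m + 1), hbound _ (by omega), .inr <| .inr <| .inr <| .inl ⟨rfl, rfl, by
        simp only [pos]; omega, by omega, mul_add_mul_le m (by omega), by
        simp [evenLabel, h1, h2, h3, add_assoc]⟩⟩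
  · have hi := i.2
    by_cases h1 : (i : ℕ) < m
    · exact ⟨i, hbound _ h1, .inr <| .inr <| .inr <| .inr <| .inl ⟨rfl, rfl, rfl, by
        simp [evenLabel, h1, add_assoc]⟩⟩
    · exact ⟨i - m, hbound _ (by omega), .inr <| .inr <| .inr <| .inr <| .inr <| .inl
        ⟨rfl, rfl, by simp only [pos]; omega, by simp [evenLabel, h1, add_assoc]⟩⟩
  · have hi := i.2
    by_cases h1 : (i : ℕ) < m
    · exact ⟨i, hbound _ h1, .inr <| .inr <| .inr <| .inr <| .inr <| .inr <| .inl
        ⟨rfl, rfl, mul_add_le_of_lt _ j.2, by simp [evenLabel, h1, add_assoc, idx]⟩⟩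
    · exact ⟨i - m, hbound _ (by omega), .inr <| .inr <| .inr <| .inr <| .inr <| .inr <| .inr
        ⟨rfl, by simp only [pos]; omega, mul_add_le_of_lt _ j.2, by
        simp [evenLabel, h1, add_assoc, idx]⟩⟩

theorem evenLabel_le {m : ℕ} (hm : 2 ≤ m) (hnm : n = 2 * m) (e : FireEdge n k) :
    evenLabel m e ≤ (k - 2) * (2 * (m * m)) + 4 * (m * m) + 8 * m - 5 := by
  obtain ⟨r, ⟨hr, hrm⟩, h⟩ := evenLabel_spec hm hnm e
  generalize evenLabel m e = L at *
  generalize (k - 2) * (2 * (m * m)) = K at *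
  generalize idx e * (2 * (m * m)) = J at *
  generalize idx e = j at *
  generalize r * m = X at *
  generalize m * m = M at *
  rcases h with h | h | h | h | h | h | h | h <;> omega

theorem le_edist_add_of_coords {u v : FireEdge n k} (huv : u ≠ v) {L L' N : ℕ}
    (h : ∀ d, (d = 1 ∧ pos u = pos v ∧ (ht u = ht v → idx u ≠ idx v)) ∨
      (2 * d + pos u ≥ pos v + ht u + ht v ∧ 2 * d + pos v ≥ pos u + ht u + ht v ∧ pos u ≠ pos v) →
      d + L < N + L' → d + L' < N + L → False) :
    N ≤ edist u v + max (L - L') (L' - L) := by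
  by_contra hlt
  rw [ne_eq, eq_iff] at huv
  have hd := edist_spec u v
  exact h (edist u v) (by omega) (by omega) (by omega)

set_option maxHeartbeats 2000000 in
theorem evenLabel_radio {m : ℕ} (hm : 2 ≤ m) (hnm : n = 2 * m) (u v : FireEdge n k) (huv : u ≠ v) :
    n + 3 ≤ edist u v + max (evenLabel m u - evenLabel m v) (evenLabel m v - evenLabel m u) := by
  wlog hht : ht u ≤ ht v generalizing u v
  · rw [edist_comm, max_comm]
    exact this v u huv.symm (le_of_not_ge hht)
  refine le_edist_add_of_coords huv fun d hd h1 h2 => ?_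
  have hmm := Nat.mul_le_mul_right m hm
  have hJ := mul_trichotomy (idx u) (idx v) (2 * (m * m))
  obtain ⟨r, ⟨hr, hrm⟩, h⟩ := evenLabel_spec hm hnm u
  obtain ⟨s, ⟨hs, hsm⟩, h'⟩ := evenLabel_spec hm hnm v
  have hrs := mul_trichotomy r s m
  clear huv
  generalize evenLabel m u = L at *
  generalize evenLabel m v = L' at *
  generalize r * m = X at *
  generalize s * m = Y at *
  generalize (k - 2) * (2 * (m * m)) = K at *
  generalize idx u * (2 * (m * m)) = J at *
  generalize idx v * (2 * (m * m)) = J' at *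
  generalize m * m = M at *
  generalize idx u = j at *
  generalize idx v = j' at *
  generalize pos u = p at *
  generalize pos v = p' at *
  generalize ht u = q at *
  generalize ht v = q' at *
  rcases h with h | h | h | h | h | h | h | h <;>
  rcases h' with h' | h' | h' | h' | h' | h' | h' | h' <;>
  first
  | exact absurd hht (by rw [h.1, h'.1]; decide)
  | rcases hd with hd | hd <;> omega

/-- An optimal radio labeling of the line graph of the firecrackers tree with `n = 2 * m + 1`. -/
def oddLabel (m : ℕ) : FireEdge n k → ℕ
  | .inl a =>
    if (a : ℕ) = m then 0
    else 7 * m + 7 + (k - 2) * (2 * (m * m) + 2 * m + 1) + 2 * (m * m) +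
      if (a : ℕ) < m then 2 * (a * m) + 7 * a
      else 2 * ((a - (m + 1)) * m) + 7 * (a - (m + 1)) + m + 3
  | .inr (.inl i) =>
    m + 3 + (k - 2) * (2 * (m * m) + 2 * m + 1) +
      if (i : ℕ) ≤ m then 2 * (i * m) + 5 * i
      else 2 * ((i - (m + 1)) * m) + 5 * (i - (m + 1)) + m + 2
  | .inr (.inr (i, j)) =>
    m + 2 + j * (2 * (m * m) + 2 * m + 1) +
      if (i : ℕ) ≤ m then 2 * (i * m) + i
      else 2 * ((i - (m + 1)) * m) + (i - (m + 1)) + m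

theorem oddLabel_spec {m : ℕ} (hnm : n = 2 * m + 1) (e : FireEdge n k) :
    ∃ r, (r ≤ m ∧ r * m ≤ m * m) ∧
      ((ht e = 0 ∧ idx e = 0 ∧ pos e = 2 * m + 1 ∧ oddLabel m e = 0) ∨
      (ht e = 0 ∧ idx e = 0 ∧ pos e = 2 * r + 1 ∧ r + 1 ≤ m ∧ r * m + 1 * m ≤ m * m ∧
        oddLabel m e =
        7 * m + 7 + (k - 2) * (2 * (m * m) + 2 * m + 1) + 2 * (m * m) + 2 * (r * m) + 7 * r) ∨
      (ht e = 0 ∧ idx e = 0 ∧ pos e = 2 * (m + 1 + r) + 1 ∧ r + 2 ≤ m ∧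
        r * m + 2 * m ≤ m * m ∧ oddLabel m e =
        7 * m + 7 + (k - 2) * (2 * (m * m) + 2 * m + 1) + 2 * (m * m) + 2 * (r * m) + 7 * r +
          m + 3) ∨
      (ht e = 1 ∧ idx e = 0 ∧ pos e = 2 * r ∧ oddLabel m e =
        m + 3 + (k - 2) * (2 * (m * m) + 2 * m + 1) + 2 * (r * m) + 5 * r) ∨
      (ht e = 1 ∧ idx e = 0 ∧ pos e = 2 * (m + 1 + r) ∧ r + 1 ≤ m ∧ r * m + 1 * m ≤ m * m ∧
        oddLabel m e = m + 3 + (k - 2) * (2 * (m * m) + 2 * m + 1) + 2 * (r * m) + 5 * r + m + 2) ∨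
      (ht e = 3 ∧ pos e = 2 * r ∧
        idx e * (2 * (m * m) + 2 * m + 1) + (2 * (m * m) + 2 * m + 1) ≤ (k - 2) * (2 * (m * m) + 2 * m + 1) ∧
        oddLabel m e = m + 2 + idx e * (2 * (m * m) + 2 * m + 1) + 2 * (r * m) + r) ∨
      (ht e = 3 ∧ pos e = 2 * (m + 1 + r) ∧ r + 1 ≤ m ∧ r * m + 1 * m ≤ m * m ∧
        idx e * (2 * (m * m) + 2 * m + 1) + (2 * (m * m) + 2 * m + 1) ≤ (k - 2) * (2 * (m * m) + 2 * m + 1) ∧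
        oddLabel m e = m + 2 + idx e * (2 * (m * m) + 2 * m + 1) + 2 * (r * m) + r + m)) := by
  have hbound : ∀ r, r ≤ m → r ≤ m ∧ r * m ≤ m * m := fun r h => ⟨h, Nat.mul_le_mul_right m h⟩
  rcases e with a | i | ⟨i, j⟩
  · have ha := a.2
    by_cases h1 : (a : ℕ) = m
    · exact ⟨0, hbound _ (by omega), .inl ⟨rfl, rfl, by simp only [pos]; omega, by
        simp [oddLabel, h1]⟩⟩
    by_cases h3 : (a : ℕ) < m
    · exact ⟨a, hbound _ h3.le, .inr <| .inl ⟨rfl, rfl, rfl, h3,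
        mul_add_mul_le m (by omega), by simp [oddLabel, h1, h3, add_assoc]⟩⟩
    · exact ⟨a - (m + 1), hbound _ (by omega), .inr <| .inr <| .inl ⟨rfl, rfl, by
        simp only [pos]; omega, by omega, mul_add_mul_le m (by omega), by
        simp [oddLabel, h1, h3, add_assoc]⟩⟩
  · have hi := i.2
    by_cases h1 : (i : ℕ) ≤ m
    · exact ⟨i, hbound _ h1, .inr <| .inr <| .inr <| .inl ⟨rfl, rfl, rfl, by
        simp [oddLabel, h1, add_assoc]⟩⟩
    · exact ⟨i - (m + 1), hbound _ (by omega), .inr <| .inr <| .inr <| .inr <| .inl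
        ⟨rfl, rfl, by simp only [pos]; omega, by omega, mul_add_mul_le m (by omega), by
        simp [oddLabel, h1, add_assoc]⟩⟩
  · have hi := i.2
    by_cases h1 : (i : ℕ) ≤ m
    · exact ⟨i, hbound _ h1, .inr <| .inr <| .inr <| .inr <| .inr <| .inl
        ⟨rfl, rfl, mul_add_le_of_lt _ j.2, by simp [oddLabel, h1, add_assoc, idx]⟩⟩
    · exact ⟨i - (m + 1), hbound _ (by omega), .inr <| .inr <| .inr <| .inr <| .inr <| .inr
        ⟨rfl, by simp only [pos]; omega, by omega, mul_add_mul_le m (by omega),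
        mul_add_le_of_lt _ j.2, by simp [oddLabel, h1, add_assoc, idx]⟩⟩

theorem oddLabel_le {m : ℕ} (hm : 1 ≤ m) (hnm : n = 2 * m + 1) (e : FireEdge n k) :
    oddLabel m e ≤ (k - 2) * (2 * (m * m) + 2 * m + 1) + 4 * (m * m) + 12 * m := by
  obtain ⟨r, ⟨hr, hrm⟩, h⟩ := oddLabel_spec hnm e
  generalize oddLabel m e = L at *
  generalize (k - 2) * (2 * (m * m) + 2 * m + 1) = K at *
  generalize idx e * (2 * (m * m) + 2 * m + 1) = J at *
  generalize idx e = j at *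
  generalize r * m = X at *
  generalize m * m = M at *
  rcases h with h | h | h | h | h | h | h <;> omega

set_option maxHeartbeats 2000000 in
theorem oddLabel_radio {m : ℕ} (hm : 1 ≤ m) (hnm : n = 2 * m + 1) (u v : FireEdge n k)
    (huv : u ≠ v) :
    n + 3 ≤ edist u v + max (oddLabel m u - oddLabel m v) (oddLabel m v - oddLabel m u) := by
  wlog hht : ht u ≤ ht v generalizing u v
  · rw [edist_comm, max_comm]
    exact this v u huv.symm (le_of_not_ge hht)
  refine le_edist_add_of_coords huv fun d hd h1 h2 => ?_
  have hmm := Nat.mul_le_mul_right m hm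
  have hJ := mul_trichotomy (idx u) (idx v) (2 * (m * m) + 2 * m + 1)
  obtain ⟨r, ⟨hr, hrm⟩, h⟩ := oddLabel_spec hnm u
  obtain ⟨s, ⟨hs, hsm⟩, h'⟩ := oddLabel_spec hnm v
  have hrs := mul_trichotomy r s m
  clear huv
  generalize oddLabel m u = L at *
  generalize oddLabel m v = L' at *
  generalize r * m = X at *
  generalize s * m = Y at *
  generalize (k - 2) * (2 * (m * m) + 2 * m + 1) = K at *
  generalize idx u * (2 * (m * m) + 2 * m + 1) = J at *
  generalize idx v * (2 * (m * m) + 2 * m + 1) = J' at *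
  generalize m * m = M at *
  generalize idx u = j at *
  generalize idx v = j' at *
  generalize pos u = p at *
  generalize pos v = p' at *
  generalize ht u = q at *
  generalize ht v = q' at *
  rcases h with h | h | h | h | h | h | h <;>
  rcases h' with h' | h' | h' | h' | h' | h' | h' <;>
  first
  | exact absurd hht (by rw [h.1, h'.1]; decide)
  | rcases hd with hd | hd <;> omega

end Labelings

/-- for `n, k ≥ 3`, the line graph of the `(n,k)`-firecrackers tree is a lower
bound block graph, and `rn(𝓛(F(n,k))) = (n²+1)k/2 + 4n - 6` if `n` is odd, and
`rn(𝓛(F(n,k))) = n²k/2 + 4n - 5` if `n` is even. -/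
theorem stmt19 (n k : ℕ) (hn : 3 ≤ n) (hk : 3 ≤ k) :
    IsLowerBoundBlockGraph (SimpleGraph.lineGraph (firecrackerTree n k)) ∧
    (rn (SimpleGraph.lineGraph (firecrackerTree n k)) : ℚ) =
      (if Odd n then ((n : ℚ) ^ 2 + 1) * (k : ℚ) / 2 + 4 * (n : ℚ) - 6
       else (n : ℚ) ^ 2 * (k : ℚ) / 2 + 4 * (n : ℚ) - 5) := by
  set G := SimpleGraph.lineGraph (firecrackerTree n k) with hG
  have hadj : ∀ u v, G.Adj (fireEquiv hn u) (fireEquiv hn v) ↔ FireEdge.edist u v = 1 :=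
    adj_fireEquiv hn
  obtain ⟨hconn, hdist⟩ := connected_and_dist_eq_edist (fireEquiv hn) hn hadj
  have hblock : IsBlockGraph G :=
    ⟨hconn, fun S hS => isClique_of_twoConn_of_coords (fireEquiv hn) hadj hS.1⟩
  obtain ⟨k', rfl⟩ := Nat.exists_eq_add_of_le' hk
  obtain ⟨m, hm | hm⟩ := Nat.even_or_odd' n
  · obtain ⟨heps, hlevel⟩ := eps_and_level_of_even (fireEquiv hn) hn hm hdist
    have hsum := sum_midDist_of_even (k := k' + 3) (by omega) hm (by omega)
    have hsq : 2 * 2 ≤ m * m := Nat.mul_le_mul (by omega) (by omega)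
    obtain ⟨hrn, hlb⟩ := rn_eq_and_lbEq (fireEquiv hn) hn hk hdist (δ := 0) (by rw [heps])
      hlevel (evenLabel m) (evenLabel_radio (by omega) hm) (evenLabel_le (by omega) hm) (by
        rw [heps, hm]
        have h1 : 2 * m * (k' + 3) * (2 * m + 2 + 1) + 12 * m =
            2 * (k' + 3) * m ^ 2 + 6 * (k' + 3) * m + 12 * m + 2 * (k' + 3) * (m * m) := by ring
        have h2 : (k' + 3 - 2) * (2 * (m * m)) + 4 * (m * m) = 2 * (k' + 3) * (m * m) := by
          rw [show k' + 3 - 2 = k' + 1 by omega]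
          ring
        subst hm
        omega)
    refine ⟨⟨hblock, hlb⟩, ?_⟩
    rw [hrn, if_neg (by rw [Nat.not_odd_iff_even]; exact ⟨m, by omega⟩), hm,
      Nat.cast_sub (by omega), show k' + 3 - 2 = k' + 1 by omega]
    push_cast
    ring
  · obtain ⟨heps, hlevel⟩ := eps_and_level_of_odd (fireEquiv hn) hm (by omega) hadj hdist
    have hsum := sum_midDist_of_odd (k := k' + 3) hm (by omega)
    obtain ⟨hrn, hlb⟩ := rn_eq_and_lbEq (fireEquiv hn) hn hk hdist (δ := 1) (by rw [heps])
      hlevel (oddLabel m) (oddLabel_radio (by omega) hm) (oddLabel_le (by omega) hm) (by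
        rw [heps, hm]
        have h1 : (2 * m + 1) * (k' + 3) * (2 * m + 1 + 2 + 0) + (2 * m + 1) * (k' + 3) =
            2 * (k' + 3) * m ^ 2 + 8 * (k' + 3) * m + 3 * (k' + 3) +
              (k' + 3) * (2 * (m * m) + 2 * m + 1) := by ring
        have h3 : 1 ≤ (2 * m + 1) * (k' + 3) := Nat.mul_pos (by omega) (by omega)
        have h2 : (k' + 3 - 2) * (2 * (m * m) + 2 * m + 1) + 2 * (2 * (m * m) + 2 * m + 1) =
            (k' + 3) * (2 * (m * m) + 2 * m + 1) := by
          rw [show k' + 3 - 2 = k' + 1 by omega]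
          ring
        subst hm
        generalize (2 * m + 1) * (k' + 3) = P at *
        omega)
    refine ⟨⟨hblock, hlb⟩, ?_⟩
    rw [hrn, if_pos ⟨m, hm⟩, hm, show k' + 3 - 2 = k' + 1 by omega]
    push_cast
    ring

end RadioLabeling
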